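/- Let F satisfy (SH) and (H1) and let φ:ℝⁿ→ℝ be locally Lipschitz. Let x̄:[t₀,T]→ℝⁿ be an optimal solution of P(t₀,x₀) and let p̄:[t₀,T]→ℝⁿ be any arc satisfying −p̄'(t) ∈ ∂ₓ⁻H(x̄(t),p̄(t)) and x̄'(t) ∈ ∂ₚH(x̄(t),p̄(t)) a.e. in [t₀,T] with the transversality condition −p̄(T) ∈ ∂⁺φ(x̄(T)) (Fréchet superdifferential). Then −p̄(t) ∈ ∂ₓ⁺V(t, x̄(t)) for all t ∈ [t₀,T], where ∂ₓ⁺V is the Fréchet superdifferential of V(t,·). -/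

import Mathlib

open MeasureTheory Filter Metric Set Topology
open scoped RealInnerProductSpace ENNReal NNReal Pointwise

noncomputable section

variable {E : Type*} [NormedAddCommGroup E] [InnerProductSpace ℝ E] [CompleteSpace E]

/-- The Hamiltonian `H(x,p) = sup_{v ∈ F x} ⟪v,p⟫` associated with `F`. -/
def Ham (F : E → Set E) (x p : E) : ℝ :=
  sSup ((fun v => ⟪v, p⟫) '' F x)

/-- Standing hypotheses (SH): nonempty convex compact values, local Lipschitz continuity
with respect to the Hausdorff metric, and sublinear growth. -/
def StandingHyp (F : E → Set E) : Prop :=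
  (∀ x, (F x).Nonempty ∧ Convex ℝ (F x) ∧ IsCompact (F x)) ∧
  (∀ x : E, ∃ ε > (0:ℝ), ∃ c : ℝ, 0 ≤ c ∧ ∀ y ∈ ball x ε, ∀ z ∈ ball x ε,
    EMetric.hausdorffEdist (F y) (F z) ≤ ENNReal.ofReal (c * dist y z)) ∧
  (∃ r > (0:ℝ), ∀ x : E, ∀ v ∈ F x, ‖v‖ ≤ r * (1 + ‖x‖))

/-- `f` is semiconvex on `K` with constant `c`. -/
def SemiconvexWith (f : E → ℝ) (K : Set E) (c : ℝ) : Prop :=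
  ∀ x h : E, x + h ∈ K → x - h ∈ K → -(c * ‖h‖ ^ 2) ≤ f (x + h) + f (x - h) - 2 * f x

/-- `f` is semiconcave on `K` with constant `c`. -/
def SemiconcaveWith (f : E → ℝ) (K : Set E) (c : ℝ) : Prop :=
  ∀ x h : E, x + h ∈ K → x - h ∈ K → f (x + h) + f (x - h) - 2 * f x ≤ c * ‖h‖ ^ 2

def LocSemiconcave (f : E → ℝ) : Prop :=
  ∀ x : E, ∃ ε > (0:ℝ), ∃ c : ℝ, SemiconcaveWith f (ball x ε) c

def LocSemiconvex (f : E → ℝ) : Prop :=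
  ∀ x : E, ∃ ε > (0:ℝ), ∃ c : ℝ, SemiconvexWith f (ball x ε) c

open scoped Classical in
/-- The gradient `∇ₚH(x,p)` of `H(x,·)` at `p` (junk value `0` if it does not exist). -/
def gradpH (F : E → Set E) (x p : E) : E :=
  if h : ∃ g, HasGradientAt (fun q => Ham F x q) g p then h.choose else 0

/-- Hypothesis (H1): semiconvexity of `H(·,p)` with constant `c‖p‖` on compact convex sets,
existence of `∇ₚH(x,p)` for `p ≠ 0`, and local Lipschitz continuity of `x ↦ ∇ₚH(x,p)`,
uniformly for `p` in compact subsets of `ℝⁿ ∖ {0}`. -/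
def HypH1 (F : E → Set E) : Prop :=
  (∀ K : Set E, K.Nonempty → Convex ℝ K → IsCompact K →
    ∃ c : ℝ, 0 ≤ c ∧ ∀ p : E, SemiconvexWith (fun x => Ham F x p) K (c * ‖p‖)) ∧
  (∀ x p : E, p ≠ 0 → HasGradientAt (fun q => Ham F x q) (gradpH F x p) p) ∧
  (∀ K : Set E, K.Nonempty → Convex ℝ K → IsCompact K →
    ∀ P : Set E, IsCompact P → (0:E) ∉ P →
      ∃ L : ℝ≥0, ∀ p ∈ P, LipschitzOnWith L (fun x => gradpH F x p) K)

/-- Fréchet subdifferential `∂⁻f(x)`. -/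
def FSub (f : E → ℝ) (x : E) : Set E :=
  {p | ∀ ε > (0:ℝ), ∀ᶠ y in 𝓝 x, -(ε * ‖y - x‖) ≤ f y - f x - ⟪p, y - x⟫}

/-- Fréchet superdifferential `∂⁺f(x)`. -/
def FSuper (f : E → ℝ) (x : E) : Set E :=
  {p | ∀ ε > (0:ℝ), ∀ᶠ y in 𝓝 x, f y - f x - ⟪p, y - x⟫ ≤ ε * ‖y - x‖}

/-- Proximal superdifferential `∂^{+,pr}f(x)`. -/
def ProxSuper (f : E → ℝ) (x : E) : Set E :=
  {p | ∃ c : ℝ, 0 ≤ c ∧ ∃ ρ > (0:ℝ), ∀ y ∈ closedBall x ρ,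
    f y - f x - ⟪p, y - x⟫ ≤ c * ‖y - x‖ ^ 2}

/-- Clarke's generalized gradient of `f` at `x`:
`ζ ∈ ∂f(x)` iff `⟪ζ,v⟫ ≤ limsup_{y→x, h→0⁺} (f(y+hv)-f(y))/h` for all `v`. -/
def ClarkeGrad (f : E → ℝ) (x : E) : Set E :=
  {ζ | ∀ v : E, ∀ ε > (0:ℝ),
    ∃ᶠ q : E × ℝ in (𝓝 x) ×ˢ (𝓝[>] (0:ℝ)),
      ⟪ζ, v⟫ - ε ≤ (f (q.1 + q.2 • v) - f q.1) / q.2}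

/-- `x` is absolutely continuous on `[t0,T]` with (a.e.) derivative `x'`. -/
def ACArc (t0 T : ℝ) (x x' : ℝ → E) : Prop :=
  IntervalIntegrable x' volume t0 T ∧
  (∀ s ∈ Icc t0 T, x s = x t0 + ∫ r in t0..s, x' r) ∧
  (∀ᵐ s ∂volume, s ∈ Icc t0 T → HasDerivAt x (x' s) s)

/-- `x` is a trajectory of the differential inclusion `x' ∈ F(x)` on `[t0,T]`. -/
def IsTraj (F : E → Set E) (t0 T : ℝ) (x x' : ℝ → E) : Prop :=
  ACArc t0 T x x' ∧ ∀ᵐ s ∂volume, s ∈ Icc t0 T → x' s ∈ F (x s)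

/-- `x` is an optimal trajectory for the Mayer problem `P(t0,x0)`. -/
def IsOptimal (F : E → Set E) (φ : E → ℝ) (t0 T : ℝ) (x0 : E) (x x' : ℝ → E) : Prop :=
  IsTraj F t0 T x x' ∧ x t0 = x0 ∧
  ∀ y y' : ℝ → E, IsTraj F t0 T y y' → y t0 = x0 → φ (x T) ≤ φ (y T)

/-- The value function of the Mayer problem. -/
def valueFn (F : E → Set E) (φ : E → ℝ) (T t : ℝ) (x : E) : ℝ :=
  sInf {r | ∃ y y' : ℝ → E, IsTraj F t T y y' ∧ y t = x ∧ r = φ (y T)}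

/-- Fréchet superdifferential of `W` in the pair `(t,x)`. -/
def FSuperPair (W : ℝ → E → ℝ) (t : ℝ) (x : E) : Set (ℝ × E) :=
  {q | ∀ ε > (0:ℝ), ∀ᶠ sy : ℝ × E in 𝓝 (t, x),
    W sy.1 sy.2 - W t x - q.1 * (sy.1 - t) - ⟪q.2, sy.2 - x⟫ ≤
      ε * ‖((sy.1 - t, sy.2 - x) : ℝ × E)‖}

/-- Fréchet subdifferential of `W` in the pair `(t,x)`. -/
def FSubPair (W : ℝ → E → ℝ) (t : ℝ) (x : E) : Set (ℝ × E) :=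
  {q | ∀ ε > (0:ℝ), ∀ᶠ sy : ℝ × E in 𝓝 (t, x),
    -(ε * ‖((sy.1 - t, sy.2 - x) : ℝ × E)‖) ≤
      W sy.1 sy.2 - W t x - q.1 * (sy.1 - t) - ⟪q.2, sy.2 - x⟫}

/-- Proximal superdifferential of `W` in the pair `(t,x)`. -/
def ProxSuperPair (W : ℝ → E → ℝ) (t : ℝ) (x : E) : Set (ℝ × E) :=
  {q | ∃ c : ℝ, 0 ≤ c ∧ ∃ ρ > (0:ℝ), ∀ s : ℝ, ∀ y : E,
    dist ((s, y) : ℝ × E) ((t, x) : ℝ × E) ≤ ρ →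
      W s y - W t x - q.1 * (s - t) - ⟪q.2, y - x⟫ ≤ c * ‖((s - t, y - x) : ℝ × E)‖ ^ 2}

/-- `V` is differentiable at `(t,x)` with (pair) gradient `q = (∂ₜV, ∇ₓV)`. -/
def HasGradPair (W : ℝ → E → ℝ) (t : ℝ) (x : E) (q : ℝ × E) : Prop :=
  HasFDerivAt (fun sy : ℝ × E => W sy.1 sy.2)
    (q.1 • ContinuousLinearMap.fst ℝ ℝ E +
      (innerSL ℝ q.2).comp (ContinuousLinearMap.snd ℝ ℝ E)) (t, x)

/-- The reachable (limiting) gradient `∂*W(t,x)`. -/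
def ReachGradPair (W : ℝ → E → ℝ) (t : ℝ) (x : E) : Set (ℝ × E) :=
  {q | ∃ u g : ℕ → ℝ × E,
    (∀ i, HasGradPair W (u i).1 (u i).2 (g i)) ∧
    Tendsto u atTop (𝓝 (t, x)) ∧ Tendsto g atTop (𝓝 q)}

/-- Normal cone (of convex analysis) to `A` at `z`. -/
def normalConeAt (A : Set E) (z : E) : Set E :=
  {p | ∀ v ∈ A, ⟪p, v - z⟫ ≤ 0}

/-- `A` is `R`-convex. -/
def RConvex (A : Set E) (R : ℝ) : Prop :=
  ∀ z ∈ frontier A, ∀ y ∈ frontier A, ∀ n ∈ normalConeAt A z, ∀ m ∈ normalConeAt A y,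
    ‖n‖ = 1 → ‖m‖ = 1 → ‖z - y‖ ≤ R * ‖n - m‖

/-- `F` is locally strongly convex. -/
def LocStronglyConvex (F : E → Set E) : Prop :=
  ∀ K : Set E, IsCompact K → ∃ R > (0:ℝ), ∀ x ∈ K, RConvex (F x) R

/-- `ℝⁿ` as a Euclidean space. -/
abbrev Euc (n : ℕ) : Type := EuclideanSpace ℝ (Fin n)

/-! ### The Hamiltonian -/

section Hamiltonian

variable {F : E → Set E} {x p v : E}

theorem inner_le_ham (hF : IsCompact (F x)) (hv : v ∈ F x) (p : E) : ⟪v, p⟫ ≤ Ham F x p :=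
  le_csSup (hF.image (by fun_prop)).bddAbove (mem_image_of_mem _ hv)

theorem exists_inner_eq_ham (hF : IsCompact (F x)) (hne : (F x).Nonempty) (p : E) :
    ∃ v ∈ F x, ⟪v, p⟫ = Ham F x p := by
  obtain ⟨v, hv, h⟩ := hF.exists_sSup_image_eq hne (f := fun v => ⟪v, p⟫) (by fun_prop)
  exact ⟨v, hv, h.symm⟩

/-- The face of `F x` on which `⟪·, p⟫` attains its maximum `H(x,p)`. -/
def maxFace (F : E → Set E) (x p : E) : Set E :=
  {v ∈ F x | ⟪v, p⟫ = Ham F x p}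

theorem maxFace_nonempty (hF : IsCompact (F x)) (hne : (F x).Nonempty) (p : E) :
    (maxFace F x p).Nonempty := by
  obtain ⟨v, hv, h⟩ := exists_inner_eq_ham hF hne p
  exact ⟨v, hv, h⟩

theorem isClosed_maxFace (hF : IsCompact (F x)) (p : E) : IsClosed (maxFace F x p) :=
  hF.isClosed.inter (isClosed_eq (by fun_prop) continuous_const)

theorem ham_zero (hF : IsCompact (F x)) (hne : (F x).Nonempty) : Ham F x 0 = 0 := by
  obtain ⟨v, -, h⟩ := exists_inner_eq_ham hF hne 0
  rw [← h, inner_zero_right]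

theorem maxFace_zero (hF : IsCompact (F x)) (hne : (F x).Nonempty) : maxFace F x 0 = F x := by
  ext v
  simp [maxFace, ham_zero hF hne]

theorem ham_smul (hF : IsCompact (F x)) (hne : (F x).Nonempty) {c : ℝ} (hc : 0 ≤ c) (p : E) :
    Ham F x (c • p) = c * Ham F x p := by
  apply le_antisymm
  · obtain ⟨v, hv, h⟩ := exists_inner_eq_ham hF hne (c • p)
    rw [← h, inner_smul_right]
    exact mul_le_mul_of_nonneg_left (inner_le_ham hF hv p) hc
  · obtain ⟨v, hv, h⟩ := exists_inner_eq_ham hF hne p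
    rw [← h, ← inner_smul_right]
    exact inner_le_ham hF hv _

theorem maxFace_subset_maxFace_smul (hF : IsCompact (F x)) (hne : (F x).Nonempty) {c : ℝ}
    (hc : 0 ≤ c) (p : E) : maxFace F x p ⊆ maxFace F x (c • p) := by
  rintro v ⟨hv, h⟩
  exact ⟨hv, by rw [inner_smul_right, h, ham_smul hF hne hc]⟩

/-- Where the Hamiltonian is differentiable in `p`, the maximum is attained only at the gradient. -/
theorem eq_gradient_of_mem_maxFace (hF : IsCompact (F x)) {g : E}
    (hg : HasGradientAt (fun q => Ham F x q) g p) (hv : v ∈ maxFace F x p) : v = g := by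
  have hmin : IsLocalMin (fun q => Ham F x q - ⟪v, q⟫) p := by
    refine Eventually.of_forall fun q => ?_
    have := inner_le_ham hF hv.1 q
    simp only [hv.2, sub_self]
    linarith
  have hd : HasFDerivAt (fun q => Ham F x q - ⟪v, q⟫)
      (InnerProductSpace.toDual ℝ E g - innerSL ℝ v) p :=
    hg.hasFDerivAt.sub (innerSL ℝ v).hasFDerivAt
  have h0 := hmin.hasFDerivAt_eq_zero hd
  refine ext_inner_right ℝ fun w => ?_
  have := DFunLike.congr_fun h0 w
  simp at this
  linarith

theorem maxFace_eq_singleton (hF : IsCompact (F x)) (hne : (F x).Nonempty)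
    (hg : HasGradientAt (fun q => Ham F x q) (gradpH F x p) p) :
    maxFace F x p = {gradpH F x p} :=
  (maxFace_nonempty hF hne p).subset_singleton_iff.1 fun _ hv =>
    eq_gradient_of_mem_maxFace hF hg hv

theorem gradpH_smul (hF : IsCompact (F x)) (hne : (F x).Nonempty)
    (hH : ∀ p : E, p ≠ 0 → HasGradientAt (fun q => Ham F x q) (gradpH F x p) p)
    {c : ℝ} (hc : 0 < c) (hp : p ≠ 0) : gradpH F x (c • p) = gradpH F x p := by
  have h := maxFace_subset_maxFace_smul hF hne hc.le p
  rw [maxFace_eq_singleton hF hne (hH p hp),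
    maxFace_eq_singleton hF hne (hH _ (smul_ne_zero hc.ne' hp))] at h
  exact (singleton_subset_singleton.1 h).symm

/-- A velocity in Clarke's gradient of `H(x,·)` at `p` attains the maximum in the Hamiltonian. -/
theorem mem_maxFace_of_mem_clarkeGrad (hF : IsCompact (F x)) (hne : (F x).Nonempty)
    (hcont : Continuous fun q => Ham F x q) (hvF : v ∈ F x)
    (hv : v ∈ ClarkeGrad (fun q => Ham F x q) p) : v ∈ maxFace F x p := by
  refine ⟨hvF, le_antisymm (inner_le_ham hF hvF p) (le_of_forall_pos_le_add fun ε hε => ?_)⟩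
  have hlim : Tendsto (fun q : E × ℝ => Ham F x (q.1 - p) - Ham F x q.1)
      ((𝓝 p) ×ˢ (𝓝[>] (0:ℝ))) (𝓝 (Ham F x (p - p) - Ham F x p)) :=
    (((hcont.comp (continuous_id.sub continuous_const)).sub hcont).tendsto p).comp tendsto_fst
  rw [sub_self, ham_zero hF hne, zero_sub] at hlim
  have hev : ∀ᶠ q : E × ℝ in (𝓝 p) ×ˢ (𝓝[>] (0:ℝ)),
      Ham F x (q.1 - p) - Ham F x q.1 < -Ham F x p + ε / 2 ∧ 0 < q.2 ∧ q.2 < 1 := by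
    refine (hlim.eventually_lt_const (by linarith)).and ?_
    have : ∀ᶠ h : ℝ in 𝓝[>] (0:ℝ), 0 < h ∧ h < 1 :=
      Ioo_mem_nhdsGT (zero_lt_one)
    exact tendsto_snd.eventually this
  obtain ⟨⟨q, h⟩, h1, h2, h3, h4⟩ := ((hv (-p) (ε / 2) (by positivity)).and_eventually hev).exists
  simp only at h1 h2 h3 h4
  obtain ⟨w, hw, hwe⟩ := exists_inner_eq_ham hF hne (q + h • (-p))
  have e : ⟪w, q + h • (-p)⟫ = (1 - h) * ⟪w, q⟫ + h * ⟪w, q - p⟫ := by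
    simp only [inner_add_right, inner_smul_right, inner_neg_right, inner_sub_right]; ring
  have i1 := mul_le_mul_of_nonneg_left (inner_le_ham hF hw q) (by linarith : 0 ≤ 1 - h)
  have i2 := mul_le_mul_of_nonneg_left (inner_le_ham hF hw (q - p)) h3.le
  have i3 : (Ham F x (q + h • (-p)) - Ham F x q) / h ≤ Ham F x (q - p) - Ham F x q := by
    rw [div_le_iff₀ h3, ← hwe, e]
    linarith
  rw [inner_neg_right] at h1
  linarith

end Hamiltonian

/-! ### Subgradients of semiconvex functions -/

/-- A Fréchet subgradient of a semiconvex function is a proximal subgradient, uniformly. -/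
theorem le_of_mem_fSub_of_semiconvexWith {f : E → ℝ} {K : Set E} {c : ℝ} (hc : 0 ≤ c)
    (hK : Convex ℝ K) (hf : SemiconvexWith f K c) {x y p : E} (hx : x ∈ K) (hy : y ∈ K)
    (hp : p ∈ FSub f x) : -(c * ‖y - x‖ ^ 2) ≤ f y - f x - ⟪p, y - x⟫ := by
  set h := y - x with hh
  set g : ℝ → ℝ := fun r => f (x + r • h) - f x - ⟪p, r • h⟫ with hg
  have hmem : ∀ r ∈ Icc (0:ℝ) 1, x + r • h ∈ K := fun r hr =>
    hK.add_smul_sub_mem hx hy hr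
  have hhalf : ∀ r ∈ Icc (0:ℝ) 1, 2 * g (r / 2) - c * ‖h‖ ^ 2 / 4 * r ^ 2 ≤ g r := by
    intro r hr
    have h1 := hf (x + (r / 2) • h) ((r / 2) • h)
    have e1 : x + (r / 2) • h + (r / 2) • h = x + r • h := by
      rw [add_assoc, ← add_smul]; congr 2; ring
    have e2 : x + (r / 2) • h - (r / 2) • h = x := by abel
    rw [e1, e2] at h1
    have h2 := h1 (hmem r hr) hx
    rw [norm_smul, mul_pow, Real.norm_eq_abs, sq_abs] at h2
    simp only [hg, inner_smul_right]
    linarith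
  have hpow : ∀ k : ℕ, 2 ^ k * g ((1 / 2) ^ k) - c * ‖h‖ ^ 2 / 2 * (1 - (1 / 2) ^ k) ≤ g 1 := by
    intro k
    induction k with
    | zero => simp
    | succ k ih =>
      have hk : ((1:ℝ) / 2) ^ k ∈ Icc (0:ℝ) 1 :=
        ⟨by positivity, pow_le_one₀ (by norm_num) (by norm_num)⟩
      have h1 := mul_le_mul_of_nonneg_left (hhalf _ hk) (by positivity : (0:ℝ) ≤ 2 ^ k)
      have e : ((1:ℝ) / 2) ^ k / 2 = (1 / 2) ^ (k + 1) := by rw [pow_succ]; ring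
      have e3 : (2:ℝ) ^ k * (1 / 2) ^ k = 1 := by rw [← mul_pow]; norm_num
      rw [e] at h1
      have e4 : (2:ℝ) ^ k * (2 * g ((1 / 2) ^ (k + 1)) - c * ‖h‖ ^ 2 / 4 * ((1 / 2) ^ k) ^ 2)
          = 2 ^ (k + 1) * g ((1 / 2) ^ (k + 1))
            - c * ‖h‖ ^ 2 / 4 * (((2:ℝ) ^ k * (1 / 2) ^ k) * (1 / 2) ^ k) := by ring
      rw [e4, e3] at h1
      have e5 : ((1:ℝ) / 2) ^ (k + 1) = (1 / 2) ^ k / 2 := e.symm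
      have e6 : c * ‖h‖ ^ 2 / 2 * (1 - (1 / 2) ^ (k + 1))
        = c * ‖h‖ ^ 2 / 2 * (1 - (1 / 2) ^ k) + c * ‖h‖ ^ 2 / 4 * (1 * (1 / 2) ^ k) := by
        rw [e5]; ring
      linarith
  have hg1 : g 1 = f y - f x - ⟪p, h⟫ := by simp [hg, hh]
  rw [← hg1]
  refine le_of_forall_pos_le_add fun ε hε => ?_
  have hT : Tendsto (fun k : ℕ => x + ((1:ℝ) / 2) ^ k • h) atTop (𝓝 x) := by
    have : Tendsto (fun k : ℕ => ((1:ℝ) / 2) ^ k) atTop (𝓝 0) :=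
      tendsto_pow_atTop_nhds_zero_of_lt_one (by norm_num) (by norm_num)
    simpa using tendsto_const_nhds.add (this.smul_const h)
  obtain ⟨k, hk⟩ := (hT.eventually (hp (ε / (‖h‖ + 1)) (by positivity))).exists
  have hk' : -(ε * (1 / 2) ^ k) ≤ g ((1 / 2) ^ k) := by
    simp only [add_sub_cancel_left] at hk
    refine le_trans (neg_le_neg ?_) hk
    rw [norm_smul, Real.norm_of_nonneg (by positivity)]
    have : ε / (‖h‖ + 1) * ‖h‖ ≤ ε := by
      rw [div_mul_eq_mul_div, div_le_iff₀ (by positivity)]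
      nlinarith
    calc ε / (‖h‖ + 1) * ((1 / 2) ^ k * ‖h‖) = ε / (‖h‖ + 1) * ‖h‖ * (1 / 2) ^ k := by ring
      _ ≤ ε * (1 / 2) ^ k := mul_le_mul_of_nonneg_right this (by positivity)
  have h1 := mul_le_mul_of_nonneg_left hk' (by positivity : (0:ℝ) ≤ 2 ^ k)
  have e3 : (2:ℝ) ^ k * (-(ε * (1 / 2) ^ k)) = -ε := by
    rw [mul_neg, mul_left_comm, ← mul_pow]; norm_num
  rw [e3] at h1
  have h2 := hpow k
  have h3 : 0 ≤ c * ‖h‖ ^ 2 := by positivity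
  have h4 : 0 ≤ c * ‖h‖ ^ 2 * (1 / 2) ^ k := by positivity
  linarith

theorem eventually_fst_mem_closedBall (x₀ p₀ : E) :
    ∀ᶠ q : E × E in 𝓝 (x₀, p₀), q.1 ∈ closedBall (0:E) (‖x₀‖ + 1) := by
  filter_upwards [continuous_fst.continuousAt.preimage_mem_nhds (ball_mem_nhds x₀ one_pos)]
    with q hq
  have hq' : ‖q.1 - x₀‖ < 1 := by simpa [dist_eq_norm] using hq
  have := norm_le_insert' q.1 x₀
  simp only [mem_closedBall_zero_iff]
  linarith

/-! ### Set-valued maps satisfying the standing hypotheses -/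

section StandingHyp

variable {F : E → Set E}

theorem StandingHyp.nonempty (hF : StandingHyp F) (x : E) : (F x).Nonempty := (hF.1 x).1

theorem StandingHyp.convex (hF : StandingHyp F) (x : E) : Convex ℝ (F x) := (hF.1 x).2.1

theorem StandingHyp.isCompact (hF : StandingHyp F) (x : E) : IsCompact (F x) := (hF.1 x).2.2

theorem StandingHyp.exists_norm_le (hF : StandingHyp F) (R : ℝ) :
    ∃ B, 0 ≤ B ∧ ∀ x ∈ closedBall (0:E) R, ∀ v ∈ F x, ‖v‖ ≤ B := by
  obtain ⟨r, hr, h⟩ := hF.2.2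
  refine ⟨r * (1 + |R|), by positivity, fun x hx v hv => (h x v hv).trans ?_⟩
  have := mem_closedBall_zero_iff.1 hx
  have := le_abs_self R
  gcongr
  linarith

open TopologicalSpace in
theorem StandingHyp.exists_lipschitz [ProperSpace E] (hF : StandingHyp F) (R : ℝ) :
    ∃ L : ℝ, 0 ≤ L ∧ ∀ x ∈ closedBall (0:E) R, ∀ x' ∈ closedBall (0:E) R, ∀ v ∈ F x',
      ∃ w ∈ F x, ‖w - v‖ ≤ L * ‖x - x'‖ := by
  set G : E → NonemptyCompacts E := fun x => ⟨⟨F x, hF.isCompact x⟩, hF.nonempty x⟩ with hG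
  have hdist : ∀ x y, edist (G x) (G y) = Metric.hausdorffEDist (F x) (F y) := fun x y => rfl
  have hloc : LocallyLipschitzOn (closedBall (0:E) R) G := by
    intro x _
    obtain ⟨ε, hε, c, hc, h⟩ := hF.2.1 x
    refine ⟨c.toNNReal, ball x ε, mem_nhdsWithin_of_mem_nhds (ball_mem_nhds x hε), ?_⟩
    intro y hy z hz
    rw [hdist]
    refine (h y hy z hz).trans_eq ?_
    rw [ENNReal.ofReal_mul hc, edist_dist]
    rfl
  obtain ⟨L, hL⟩ := hloc.exists_lipschitzOnWith_of_compact (isCompact_closedBall 0 R)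
  refine ⟨L, L.2, fun x hx x' hx' v hv => ?_⟩
  obtain ⟨w, hw, hwd⟩ := (hF.isCompact x).exists_infDist_eq_dist (hF.nonempty x) v
  refine ⟨w, hw, ?_⟩
  have h1 : Metric.infDist v (F x) ≤ Metric.hausdorffDist (F x') (F x) :=
    Metric.infDist_le_hausdorffDist_of_mem hv (edist_ne_top (G x') (G x))
  have h2 : dist (G x') (G x) ≤ L * dist x' x := hL.dist_le_mul x' hx' x hx
  rw [← dist_eq_norm, ← dist_eq_norm, dist_comm w v, dist_comm x x', ← hwd]
  exact h1.trans h2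

theorem StandingHyp.continuous_ham [ProperSpace E] (hF : StandingHyp F) :
    Continuous fun q : E × E => Ham F q.1 q.2 := by
  rw [continuous_iff_continuousAt]
  rintro ⟨x₀, p₀⟩
  obtain ⟨B, hB0, hB⟩ := hF.exists_norm_le (‖x₀‖ + 1)
  obtain ⟨L, hL0, hL⟩ := hF.exists_lipschitz (‖x₀‖ + 1)
  have hx₀ : x₀ ∈ closedBall (0:E) (‖x₀‖ + 1) := by simp
  have key : ∀ x ∈ closedBall (0:E) (‖x₀‖ + 1), ∀ y ∈ closedBall (0:E) (‖x₀‖ + 1), ∀ p q,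
      Ham F x p - Ham F y q ≤ L * ‖y - x‖ * ‖p‖ + B * ‖p - q‖ := by
    intro x hx y hy p q
    obtain ⟨v, hv, hve⟩ := exists_inner_eq_ham (hF.isCompact x) (hF.nonempty x) p
    obtain ⟨w, hw, hwv⟩ := hL y hy x hx v hv
    have h1 := inner_le_ham (hF.isCompact y) hw q
    have h2 : ⟪v, p⟫ - ⟪w, q⟫ = ⟪v - w, p⟫ + ⟪w, p - q⟫ := by
      simp only [inner_sub_left, inner_sub_right]; ring
    have h3 : ⟪v - w, p⟫ ≤ L * ‖y - x‖ * ‖p‖ := by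
      refine (real_inner_le_norm _ _).trans ?_
      rw [norm_sub_rev]
      gcongr
    have h4 : ⟪w, p - q⟫ ≤ B * ‖p - q‖ := by
      refine (real_inner_le_norm _ _).trans ?_
      gcongr
      exact hB y hy w hw
    linarith
  have hev := eventually_fst_mem_closedBall x₀ p₀
  rw [ContinuousAt, tendsto_iff_dist_tendsto_zero]
  refine squeeze_zero' (Eventually.of_forall fun _ => dist_nonneg)
    (g := fun q : E × E => L * ‖q.1 - x₀‖ * (‖q.2‖ + ‖p₀‖) + B * ‖q.2 - p₀‖) ?_ ?_
  · filter_upwards [hev] with q hq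
    rw [Real.dist_eq, abs_le]
    have h1 := key _ hq _ hx₀ q.2 p₀
    have h2 := key _ hx₀ _ hq p₀ q.2
    rw [norm_sub_rev p₀] at h2
    rw [norm_sub_rev x₀] at h1
    have h3 : 0 ≤ L * ‖q.1 - x₀‖ * ‖q.2‖ := by positivity
    have h4 : 0 ≤ L * ‖q.1 - x₀‖ * ‖p₀‖ := by positivity
    constructor <;> linarith
  · have : Continuous fun q : E × E => L * ‖q.1 - x₀‖ * (‖q.2‖ + ‖p₀‖) + B * ‖q.2 - p₀‖ := by
      fun_prop
    simpa using this.tendsto (x₀, p₀)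

/-- The point of `F x` nearest to `v`, described by its variational inequality. -/
def nearestPt (F : E → Set E) (x v : E) : E :=
  Classical.epsilon fun w => w ∈ F x ∧ ∀ z ∈ F x, ⟪v - w, z - w⟫ ≤ 0

theorem StandingHyp.nearestPt_spec (hF : StandingHyp F) (x v : E) :
    nearestPt F x v ∈ F x ∧ ∀ z ∈ F x, ⟪v - nearestPt F x v, z - nearestPt F x v⟫ ≤ 0 := by
  refine Classical.epsilon_spec (p := fun w => w ∈ F x ∧ ∀ z ∈ F x, ⟪v - w, z - w⟫ ≤ 0) ?_
  obtain ⟨w, hw, hwv⟩ := exists_norm_eq_iInf_of_complete_convex (hF.nonempty x)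
    (hF.isCompact x).isComplete (hF.convex x) v
  exact ⟨w, hw, (norm_eq_iInf_iff_real_inner_le_zero (hF.convex x) hw).1 hwv⟩

theorem StandingHyp.norm_nearestPt_sub_le (hF : StandingHyp F) {x w : E} (v : E) (hw : w ∈ F x) :
    ‖nearestPt F x v - v‖ ≤ ‖w - v‖ := by
  obtain ⟨h1, h2⟩ := hF.nearestPt_spec x v
  have h3 := (norm_eq_iInf_iff_real_inner_le_zero (hF.convex x) h1).2 h2
  rw [norm_sub_rev, norm_sub_rev w, h3]
  exact ciInf_le (f := fun w : F x => ‖v - w‖) ⟨0, by rintro _ ⟨_, rfl⟩; positivity⟩ ⟨w, hw⟩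

theorem StandingHyp.continuous_nearestPt [ProperSpace E] (hF : StandingHyp F) :
    Continuous fun q : E × E => nearestPt F q.1 q.2 := by
  rw [continuous_iff_continuousAt]
  rintro ⟨x₀, v₀⟩
  obtain ⟨B, hB0, hB⟩ := hF.exists_norm_le (‖x₀‖ + 1)
  obtain ⟨L, hL0, hL⟩ := hF.exists_lipschitz (‖x₀‖ + 1)
  have hx₀ : x₀ ∈ closedBall (0:E) (‖x₀‖ + 1) := by simp
  have key : ∀ x ∈ closedBall (0:E) (‖x₀‖ + 1), ∀ v,
      ‖nearestPt F x v - nearestPt F x₀ v₀‖ ^ 2 ≤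
        2 * B * ‖v - v₀‖ + L * ‖x - x₀‖ * (‖v‖ + ‖v₀‖ + 2 * B) := by
    intro x hx v
    obtain ⟨m, hm⟩ := hF.nearestPt_spec x v
    obtain ⟨m₀, hm₀⟩ := hF.nearestPt_spec x₀ v₀
    set w := nearestPt F x v
    set w₀ := nearestPt F x₀ v₀
    obtain ⟨z, hz, hzw⟩ := hL x hx x₀ hx₀ w₀ m₀
    obtain ⟨z₀, hz₀, hzw₀⟩ := hL x₀ hx₀ x hx w m
    have b := hB x hx w m
    have b₀ := hB x₀ hx₀ w₀ m₀
    have e : ‖w - w₀‖ ^ 2 = ⟪v - v₀, w - w₀⟫ + ⟪v - w, z - w⟫ + ⟪v₀ - w₀, z₀ - w₀⟫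
        - ⟪v - w, z - w₀⟫ - ⟪v₀ - w₀, z₀ - w⟫ := by
      rw [← real_inner_self_eq_norm_sq]
      simp only [inner_sub_left, inner_sub_right]; ring
    have h1 := hm z hz
    have h2 := hm₀ z₀ hz₀
    have h3 : ⟪v - v₀, w - w₀⟫ ≤ ‖v - v₀‖ * (2 * B) := by
      refine (real_inner_le_norm _ _).trans ?_
      gcongr
      exact (norm_sub_le _ _).trans (by linarith)
    have h4 : -⟪v - w, z - w₀⟫ ≤ (‖v‖ + B) * (L * ‖x - x₀‖) := by
      refine (neg_le_abs _).trans ((abs_real_inner_le_norm _ _).trans ?_)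
      gcongr
      exact (norm_sub_le _ _).trans (by linarith)
    have h5 : -⟪v₀ - w₀, z₀ - w⟫ ≤ (‖v₀‖ + B) * (L * ‖x - x₀‖) := by
      refine (neg_le_abs _).trans ((abs_real_inner_le_norm _ _).trans ?_)
      rw [norm_sub_rev x]
      gcongr
      exact (norm_sub_le _ _).trans (by linarith)
    linarith
  have hev := eventually_fst_mem_closedBall x₀ v₀
  have hsq : Tendsto (fun q : E × E => ‖nearestPt F q.1 q.2 - nearestPt F x₀ v₀‖ ^ 2)
      (𝓝 (x₀, v₀)) (𝓝 0) := by
    refine squeeze_zero' (Eventually.of_forall fun _ => by positivity)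
      (hev.mono fun q hq => key q.1 hq q.2) ?_
    have : Continuous fun q : E × E =>
        2 * B * ‖q.2 - v₀‖ + L * ‖q.1 - x₀‖ * (‖q.2‖ + ‖v₀‖ + 2 * B) := by
      fun_prop
    simpa using this.tendsto (x₀, v₀)
  rw [ContinuousAt, tendsto_iff_norm_sub_tendsto_zero]
  simpa [Real.sqrt_sq] using hsq.sqrt

/-! ### A measurable Lipschitz selection of the maximal faces -/

open scoped Classical in
/-- A selection of `maxFace F x p`: the gradient `∇ₚH(x,p)` if `p ≠ 0`, and the point of `F x`
nearest to `v` if `p = 0`. -/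
def faceSel (F : E → Set E) (p x v : E) : E :=
  if p = 0 then nearestPt F x v else gradpH F x p

theorem faceSel_mem (hF : StandingHyp F)
    (hH : ∀ x p : E, p ≠ 0 → HasGradientAt (fun q => Ham F x q) (gradpH F x p) p) (p x v : E) :
    faceSel F p x v ∈ maxFace F x p := by
  unfold faceSel
  split_ifs with hp
  · rw [hp, maxFace_zero (hF.isCompact x) (hF.nonempty x)]
    exact (hF.nearestPt_spec x v).1
  · rw [maxFace_eq_singleton (hF.isCompact x) (hF.nonempty x) (hH x p hp)]
    rfl

theorem exists_norm_faceSel_sub_le [ProperSpace E] (hF : StandingHyp F) (h1 : HypH1 F) {R : ℝ}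
    (hR : 0 ≤ R) :
    ∃ L : ℝ, 0 < L ∧ ∀ p, ∀ x ∈ closedBall (0:E) R, ∀ x' ∈ closedBall (0:E) R,
      ∀ v ∈ maxFace F x' p, ‖faceSel F p x v - v‖ ≤ L * ‖x - x'‖ := by
  obtain ⟨L₀, hL₀, hL⟩ := hF.exists_lipschitz R
  obtain ⟨L₁, hL₁⟩ := h1.2.2 (closedBall 0 R) (nonempty_closedBall.2 hR)
    (convex_closedBall 0 R) (isCompact_closedBall 0 R) (sphere 0 1) (isCompact_sphere 0 1) (by simp)
  refine ⟨L₀ + L₁ + 1, by positivity, fun p x hx x' hx' v hv => ?_⟩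
  unfold faceSel
  split_ifs with hp
  · obtain ⟨w, hw, hwv⟩ := hL x hx x' hx' v hv.1
    refine (hF.norm_nearestPt_sub_le v hw).trans (hwv.trans ?_)
    gcongr
    linarith [L₁.2]
  · have hgrad : ∀ y, gradpH F y (‖p‖⁻¹ • p) = gradpH F y p := fun y =>
      gradpH_smul (hF.isCompact y) (hF.nonempty y) (h1.2.1 y) (by positivity) hp
    have hs : ‖p‖⁻¹ • p ∈ sphere (0:E) 1 := by
      simp [norm_smul, hp]
    have h := (hL₁ _ hs).norm_sub_le hx hx'
    simp only [hgrad] at h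
    rw [eq_gradient_of_mem_maxFace (hF.isCompact x') (h1.2.1 x' p hp) hv]
    refine h.trans ?_
    gcongr
    linarith

theorem measurable_faceSel [FiniteDimensional ℝ E] [MeasurableSpace E] [BorelSpace E]
    (hF : StandingHyp F)
    (hH : ∀ x p : E, p ≠ 0 → HasGradientAt (fun q => Ham F x q) (gradpH F x p) p) :
    Measurable fun q : E × E × E => faceSel F q.1 q.2.1 q.2.2 := by
  have hfd : Measurable fun q : E × E × E => (InnerProductSpace.toDual ℝ E).symm
      (fderiv ℝ (fun p => Ham F q.2.1 p) q.1) := by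
    have h1 : Measurable fun q : E × E => fderiv ℝ (fun p => Ham F q.1 p) q.2 :=
      measurable_fderiv_with_param ℝ (f := fun x p => Ham F x p) hF.continuous_ham
    exact (InnerProductSpace.toDual ℝ E).symm.continuous.measurable.comp
      (h1.comp (measurable_snd.fst.prodMk measurable_fst))
  have heq : (fun q : E × E × E => faceSel F q.1 q.2.1 q.2.2) = fun q =>
      open scoped Classical in if q ∈ {q : E × E × E | q.1 = 0} then nearestPt F q.2.1 q.2.2
        else (InnerProductSpace.toDual ℝ E).symm (fderiv ℝ (fun p => Ham F q.2.1 p) q.1) := by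
    ext1 q
    unfold faceSel
    simp only [mem_ofPred_eq]
    split_ifs with hp
    · rfl
    · rw [(hH q.2.1 q.1 hp).hasFDerivAt.fderiv, LinearIsometryEquiv.symm_apply_apply]
  rw [heq]
  exact Measurable.ite (measurable_fst (measurableSet_singleton 0))
    (hF.continuous_nearestPt.measurable.comp measurable_snd) hfd

end StandingHyp

/-! ### Absolutely continuous arcs -/

section Arcs

variable {a b t : ℝ} {x x' y y' : ℝ → E}

theorem acArc_of_intervalIntegrable (hab : a ≤ b) (hu : IntervalIntegrable x' volume a b) (c : E) :
    ACArc a b (fun s => c + ∫ r in a..s, x' r) x' := by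
  refine ⟨hu, fun s _ => by simp, ?_⟩
  filter_upwards [hu.ae_hasDerivAt_integral] with s hs hsm
  rw [uIcc_of_le hab] at hs
  exact (hs hsm a (left_mem_Icc.2 hab)).const_add c

theorem intervalIntegrable_of_mem_Icc {f : ℝ → E} (hf : IntervalIntegrable f volume a b) {r s : ℝ}
    (hr : r ∈ Icc a b) (hs : s ∈ Icc a b) : IntervalIntegrable f volume r s := by
  have hab : a ≤ b := hr.1.trans hr.2
  refine hf.mono_set ?_
  rw [uIcc_of_le hab]
  exact uIcc_subset_Icc hr hs

theorem ACArc.continuousOn (hx : ACArc a b x x') : ContinuousOn x (Icc a b) := by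
  rcases lt_or_ge b a with hab | hab
  · simp [Icc_eq_empty hab.not_ge]
  · have h := intervalIntegral.continuousOn_primitive_interval' hx.1 left_mem_uIcc
    rw [uIcc_of_le hab] at h
    exact (continuousOn_const.add h).congr hx.2.1

theorem ACArc.sub_eq_integral (hx : ACArc a b x x') {r s : ℝ} (hr : r ∈ Icc a b)
    (hs : s ∈ Icc a b) : x s - x r = ∫ τ in r..s, x' τ := by
  have ha : a ∈ Icc a b := left_mem_Icc.2 (hr.1.trans hr.2)
  rw [hx.2.1 s hs, hx.2.1 r hr, add_sub_add_left_eq_sub]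
  exact intervalIntegral.integral_interval_sub_left (intervalIntegrable_of_mem_Icc hx.1 ha hs)
    (intervalIntegrable_of_mem_Icc hx.1 ha hr)

theorem ACArc.restrict_right (hx : ACArc a b x x') (ht : t ∈ Icc a b) : ACArc t b x x' := by
  have hb : b ∈ Icc a b := right_mem_Icc.2 (ht.1.trans ht.2)
  have hsub : Icc t b ⊆ Icc a b := Icc_subset_Icc_left ht.1
  refine ⟨intervalIntegrable_of_mem_Icc hx.1 ht hb, fun s hs => ?_, ?_⟩
  · rw [← hx.sub_eq_integral ht (hsub hs), add_sub_cancel]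
  · filter_upwards [hx.2.2] with s h hs using h (hsub hs)

theorem ACArc.sub (hx : ACArc a b x x') (hy : ACArc a b y y') :
    ACArc a b (fun s => x s - y s) (fun s => x' s - y' s) := by
  refine ⟨hx.1.sub hy.1, fun s hs => ?_, ?_⟩
  · have ha : a ∈ Icc a b := left_mem_Icc.2 (hs.1.trans hs.2)
    beta_reduce
    rw [intervalIntegral.integral_sub (intervalIntegrable_of_mem_Icc hx.1 ha hs)
      (intervalIntegrable_of_mem_Icc hy.1 ha hs), hx.2.1 s hs, hy.2.1 s hs]
    abel
  · filter_upwards [hx.2.2, hy.2.2] with s h1 h2 hs using (h1 hs).sub (h2 hs)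

open scoped Classical in
/-- Concatenation of two arcs meeting at time `t`. -/
theorem ACArc.concat (hx : ACArc a b x x') (ht : t ∈ Icc a b) (hy : ACArc t b y y')
    (hxy : x t = y t) :
    ACArc a b (fun s => if s ≤ t then x s else y s) (fun s => if s ≤ t then x' s else y' s) := by
  have ha : a ∈ Icc a b := left_mem_Icc.2 (ht.1.trans ht.2)
  set z' : ℝ → E := fun s => if s ≤ t then x' s else y' s with hz'
  have i1 : IntervalIntegrable z' volume a t := by
    refine (intervalIntegrable_of_mem_Icc hx.1 ha ht).congr fun r hr => ?_
    rw [uIoc_of_le ht.1] at hr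
    simp [hz', hr.2]
  have e2 : ∀ s, t ≤ s → EqOn y' z' (uIoc t s) := fun s hs r hr => by
    rw [uIoc_of_le hs] at hr
    simp [hz', hr.1.not_ge]
  have i2 : ∀ s ∈ Icc t b, IntervalIntegrable z' volume t s := fun s hs =>
    (intervalIntegrable_of_mem_Icc hy.1 (left_mem_Icc.2 ht.2) hs).congr (e2 s hs.1)
  refine ⟨i1.trans (i2 b (right_mem_Icc.2 ht.2)), fun s hs => ?_, ?_⟩
  · simp only [ht.1, if_true]
    have e3 : ∀ s ∈ Icc a t, ∫ r in a..s, z' r = x s - x a := fun s hs => by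
      rw [hx.sub_eq_integral ha ⟨hs.1, hs.2.trans ht.2⟩]
      refine intervalIntegral.integral_congr_ae (Eventually.of_forall fun r hr => ?_)
      rw [uIoc_of_le hs.1] at hr
      simp [hz', hr.2.trans hs.2]
    split_ifs with hst
    · rw [e3 s ⟨hs.1, hst⟩, add_sub_cancel]
    · push Not at hst
      rw [← intervalIntegral.integral_add_adjacent_intervals i1 (i2 s ⟨hst.le, hs.2⟩),
        e3 t ⟨ht.1, le_rfl⟩, ← intervalIntegral.integral_congr_ae
          (Eventually.of_forall fun r hr => e2 s hst.le hr),
        ← hy.sub_eq_integral (left_mem_Icc.2 ht.2) ⟨hst.le, hs.2⟩, hxy]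
      abel
  · have hne : ∀ᵐ s : ℝ, s ≠ t := by simp [ae_iff, measure_singleton]
    filter_upwards [hx.2.2, hy.2.2, hne] with s h1 h2 h3 hs
    rcases lt_or_gt_of_ne h3 with hst | hst
    · simp only [hst.le, hz', if_true]
      refine (h1 hs).congr_of_eventuallyEq ?_
      filter_upwards [Iio_mem_nhds hst] with r hr
      simp [(mem_Iio.1 hr).le]
    · simp only [hst.not_ge, hz', if_false]
      refine (h2 ⟨hst.le, hs.2⟩).congr_of_eventuallyEq ?_
      filter_upwards [Ioi_mem_nhds hst] with r hr
      simp [(mem_Ioi.1 hr).not_ge]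

/-! ### Trajectories -/

variable {F : E → Set E}

theorem IsTraj.restrict_right (hx : IsTraj F a b x x') (ht : t ∈ Icc a b) : IsTraj F t b x x' :=
  ⟨hx.1.restrict_right ht, by
    filter_upwards [hx.2] with s h hs using h (Icc_subset_Icc_left ht.1 hs)⟩

open scoped Classical in
theorem IsTraj.concat (hx : IsTraj F a b x x') (ht : t ∈ Icc a b) (hy : IsTraj F t b y y')
    (hxy : x t = y t) :
    IsTraj F a b (fun s => if s ≤ t then x s else y s) (fun s => if s ≤ t then x' s else y' s) := by
  refine ⟨hx.1.concat ht hy.1 hxy, ?_⟩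
  filter_upwards [hx.2, hy.2] with s h1 h2 hs
  split_ifs with hst
  · exact h1 hs
  · exact h2 ⟨(not_le.1 hst).le, hs.2⟩

theorem integral_exp_mul_sub {c : ℝ} (hc : 0 < c) (a s : ℝ) :
    ∫ r in a..s, Real.exp (c * (r - a)) = (Real.exp (c * (s - a)) - 1) / c := by
  have h : ∀ r ∈ uIcc a s, HasDerivAt (fun r => Real.exp (c * (r - a)) / c)
      (Real.exp (c * (r - a))) r := by
    intro r _
    have := ((((hasDerivAt_id r).sub_const a).const_mul c).exp).div_const c
    simpa [hc.ne'] using this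
  rw [intervalIntegral.integral_eq_sub_of_hasDerivAt h
    (Continuous.intervalIntegrable (by fun_prop) _ _)]
  simp [sub_div]

/-- A priori bound for trajectories of a set-valued map of sublinear growth. -/
theorem IsTraj.norm_le {r : ℝ} (hr : 0 < r) (hgrowth : ∀ x : E, ∀ v ∈ F x, ‖v‖ ≤ r * (1 + ‖x‖))
    (hx : IsTraj F a b x x') {s : ℝ} (hs : s ∈ Icc a b) :
    ‖x s‖ ≤ 2 * (‖x a‖ + r * (b - a)) * Real.exp (2 * r * (b - a)) := by
  have hab : a ≤ b := hs.1.trans hs.2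
  have hcont : ContinuousOn (fun s => Real.exp (-(2 * r * (s - a))) * ‖x s‖) (Icc a b) :=
    (Continuous.continuousOn (by fun_prop)).mul hx.1.continuousOn.norm
  obtain ⟨τ, hτ, hmax⟩ := isCompact_Icc.exists_isMaxOn (nonempty_Icc.2 hab) hcont
  set m := Real.exp (-(2 * r * (τ - a))) * ‖x τ‖ with hm
  have hm0 : 0 ≤ m := by positivity
  have hle : ∀ s ∈ Icc a b, ‖x s‖ ≤ m * Real.exp (2 * r * (s - a)) := by
    intro s hs
    have h : Real.exp (-(2 * r * (s - a))) * ‖x s‖ ≤ m := hmax hs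
    rwa [Real.exp_neg, inv_mul_le_iff₀ (Real.exp_pos _), mul_comm] at h
  have hint : ‖∫ s in a..τ, x' s‖ ≤ ∫ s in a..τ, (r + r * m * Real.exp (2 * r * (s - a))) := by
    refine intervalIntegral.norm_integral_le_of_norm_le hτ.1 ?_
      (Continuous.intervalIntegrable (by fun_prop) _ _)
    filter_upwards [hx.2] with s h hs
    have hs' : s ∈ Icc a b := ⟨hs.1.le, hs.2.trans hτ.2⟩
    refine (hgrowth _ _ (h hs')).trans ?_
    have := mul_le_mul_of_nonneg_left (hle s hs') hr.le
    linarith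
  rw [intervalIntegral.integral_add (by simp) (Continuous.intervalIntegrable (by fun_prop) _ _),
    intervalIntegral.integral_const_mul, integral_exp_mul_sub (by positivity),
    intervalIntegral.integral_const, smul_eq_mul] at hint
  have hxτ : ‖x τ‖ ≤ ‖x a‖ + ((τ - a) * r + m / 2 * (Real.exp (2 * r * (τ - a)) - 1)) := by
    rw [hx.1.2.1 τ hτ]
    refine (norm_add_le _ _).trans (add_le_add_right (hint.trans_eq ?_) _)
    field_simp
  have hE : 1 ≤ Real.exp (2 * r * (τ - a)) :=
    Real.one_le_exp (by have := hτ.1; have : 0 ≤ τ - a := by linarith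
                        positivity)
  have hxm : ‖x τ‖ = m * Real.exp (2 * r * (τ - a)) := by
    rw [hm, Real.exp_neg]; field_simp
  have hτb : (τ - a) * r ≤ r * (b - a) := by nlinarith [hτ.2]
  have hmle : m ≤ 2 * (‖x a‖ + r * (b - a)) := by
    have h0 : 0 ≤ r * (b - a) := mul_nonneg hr.le (by linarith)
    have h1 : m / 2 * Real.exp (2 * r * (τ - a)) ≤ ‖x a‖ + r * (b - a) := by linarith
    nlinarith
  refine (hle s hs).trans ?_
  have h0 : s - a ≤ b - a := by linarith [hs.2]
  gcongr

end Arcs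

/-! ### Filippov's theorem along a selection -/

section Filippov

/-- Successive approximations `u₀ = x'`, `uₖ₊₁(s) = σ(s, c + ∫ₐˢ uₖ, uₖ(s))` of the velocity of a
trajectory starting from `c` at time `a`. -/
def velocityIter (σ : ℝ → E → E → E) (a : ℝ) (c : E) (x' : ℝ → E) : ℕ → ℝ → E
  | 0 => x'
  | k + 1 => fun s =>
      σ s (c + ∫ r in a..s, velocityIter σ a c x' k r) (velocityIter σ a c x' k s)

/-- **Filippov's theorem**: near an arc `x` whose velocity belongs to `Φ s (x s)` there are arcs
`y` with `y' s ∈ Φ s (y s)` and a prescribed initial point, provided `Φ` has a Carathéodory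
selection `σ` that moves admissible velocities in a Lipschitz way. -/
theorem exists_acArc_of_selection {a b : ℝ} (hab : a ≤ b) {Φ : ℝ → E → Set E}
    {σ : ℝ → E → E → E} {K : Set E} {L δ : ℝ} {x x' : ℝ → E}
    (hcl : ∀ s z, IsClosed (Φ s z)) (hmem : ∀ s z v, σ s z v ∈ Φ s z) (hL : 0 < L)
    (hLip : ∀ s, ∀ z ∈ K, ∀ z' ∈ K, ∀ v ∈ Φ s z', ‖σ s z v - v‖ ≤ L * ‖z - z'‖)
    (hmeas : ∀ y u : ℝ → E, ContinuousOn y (Icc a b) →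
      AEStronglyMeasurable u (volume.restrict (Ioc a b)) →
      AEStronglyMeasurable (fun s => σ s (y s) (u s)) (volume.restrict (Ioc a b)))
    (hx : ACArc a b x x') (hxΦ : ∀ᵐ s ∂volume, s ∈ Icc a b → x' s ∈ Φ s (x s))
    (hK : ∀ s ∈ Icc a b, closedBall (x s) δ ⊆ K) (c : E)
    (hc : 2 * Real.exp (2 * L * (b - a)) * ‖c - x a‖ ≤ δ) :
    ∃ y y' : ℝ → E, ACArc a b y y' ∧ y a = c ∧
      (∀ᵐ s ∂volume, s ∈ Icc a b → y' s ∈ Φ s (y s)) ∧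
      ∀ s ∈ Icc a b, ‖y s - x s‖ ≤ 2 * Real.exp (2 * L * (b - a)) * ‖c - x a‖ := by
  set u := velocityIter σ a c x' with hu
  set w : ℕ → ℝ → E := fun k s => c + ∫ r in a..s, u k r with hw
  have hu0 : u 0 = x' := rfl
  have husucc : ∀ k s, u (k + 1) s = σ s (w k s) (u k s) := fun k s => rfl
  set d := ‖c - x a‖ with hd
  have hd0 : 0 ≤ d := norm_nonneg _
  have haI : a ∈ Icc a b := left_mem_Icc.2 hab
  set M := Real.exp (2 * L * (b - a)) with hM
  have hexp1 : ∀ s ∈ Icc a b, 1 ≤ Real.exp (2 * L * (s - a)) := fun s hs =>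
    Real.one_le_exp (by have : 0 ≤ s - a := by linarith [hs.1]
                        positivity)
  have hexpM : ∀ s ∈ Icc a b, Real.exp (2 * L * (s - a)) ≤ M := fun s hs => by
    have h0 : s - a ≤ b - a := by linarith [hs.2]
    rw [hM]
    gcongr
  have htubeK : ∀ k : ℕ, ∀ z, ∀ s ∈ Icc a b,
      ‖z - x s‖ ≤ (2 - (1 / 2) ^ k) * d * Real.exp (2 * L * (s - a)) → z ∈ K := by
    intro k z s hs h
    refine hK s hs (mem_closedBall_iff_norm.2 (h.trans (le_trans ?_ hc)))
    have h2 : (2 - (1 / 2 : ℝ) ^ k) ≤ 2 := by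
      have : (0:ℝ) ≤ (1 / 2) ^ k := by positivity
      linarith
    calc _ ≤ 2 * d * M := by gcongr; exact hexpM s hs
      _ = _ := by ring
  have hxK : ∀ s ∈ Icc a b, x s ∈ K := fun s hs =>
    hK s hs (mem_closedBall_self (le_trans (by positivity) hc))
  have hcont : ∀ k, IntervalIntegrable (u k) volume a b → ContinuousOn (w k) (Icc a b) :=
    fun k hk => (acArc_of_intervalIntegrable hab hk c).continuousOn
  have hstep : ∀ k, IntervalIntegrable (u k) volume a b → ∀ B : ℝ,
      (∀ᵐ s ∂volume, s ∈ Icc a b → ‖u (k + 1) s - u k s‖ ≤ B) →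
      IntervalIntegrable (u (k + 1)) volume a b := by
    intro k hk B hB
    have hk' := (intervalIntegrable_iff_integrableOn_Ioc_of_le hab).1 hk
    rw [intervalIntegrable_iff_integrableOn_Ioc_of_le hab]
    have hm : AEStronglyMeasurable (u (k + 1)) (volume.restrict (Ioc a b)) :=
      hmeas (w k) (u k) (hcont k hk) hk'.aestronglyMeasurable
    have hdiff : Integrable (u (k + 1) - u k) (volume.restrict (Ioc a b)) := by
      refine Integrable.mono' (integrable_const B) (hm.sub hk'.aestronglyMeasurable) ?_
      rw [ae_restrict_iff' measurableSet_Ioc]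
      filter_upwards [hB] with s h hs using h (Ioc_subset_Icc_self hs)
    have hadd := hdiff.add hk'.integrable
    rwa [sub_add_cancel] at hadd
  have main : ∀ k : ℕ, IntervalIntegrable (u k) volume a b ∧
      IntervalIntegrable (u (k + 1)) volume a b ∧
      (∀ s ∈ Icc a b, ‖w k s - x s‖ ≤ (2 - (1 / 2) ^ k) * d * Real.exp (2 * L * (s - a))) ∧
      (∀ᵐ s ∂volume, s ∈ Icc a b →
        ‖u (k + 1) s - u k s‖ ≤ L * (1 / 2) ^ k * d * Real.exp (2 * L * (s - a))) := by
    have hconst : ∀ k : ℕ, (∀ᵐ s ∂volume, s ∈ Icc a b →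
        ‖u (k + 1) s - u k s‖ ≤ L * (1 / 2) ^ k * d * Real.exp (2 * L * (s - a))) →
        ∀ᵐ s ∂volume, s ∈ Icc a b → ‖u (k + 1) s - u k s‖ ≤ L * (1 / 2) ^ k * d * M := by
      intro k h
      filter_upwards [h] with s h hs
      refine (h hs).trans ?_
      gcongr
      exact hexpM s hs
    intro k
    induction k with
    | zero =>
      have hwx : ∀ s ∈ Icc a b, ‖w 0 s - x s‖ = d := by
        intro s hs
        simp only [hw, hu0]
        rw [hx.2.1 s hs, add_sub_add_right_eq_sub]
      have h3 : ∀ s ∈ Icc a b,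
          ‖w 0 s - x s‖ ≤ (2 - (1 / 2) ^ 0) * d * Real.exp (2 * L * (s - a)) := by
        intro s hs
        rw [hwx s hs]
        have := mul_le_mul_of_nonneg_left (hexp1 s hs) hd0
        norm_num
        linarith
      have h4 : ∀ᵐ s ∂volume, s ∈ Icc a b →
          ‖u 1 s - u 0 s‖ ≤ L * (1 / 2) ^ 0 * d * Real.exp (2 * L * (s - a)) := by
        filter_upwards [hxΦ] with s h hs
        rw [husucc 0 s, hu0]
        refine (hLip s _ (htubeK 0 _ s hs (h3 s hs)) _ (hxK s hs) _ (h hs)).trans ?_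
        rw [hwx s hs]
        have := mul_le_mul_of_nonneg_left (hexp1 s hs) (mul_nonneg hL.le hd0)
        norm_num
        linarith
      exact ⟨hx.1, hstep 0 hx.1 _ (hconst 0 h4), h3, h4⟩
    | succ k ih =>
      obtain ⟨h1, h2, h3, h4⟩ := ih
      have hww : ∀ s ∈ Icc a b,
          ‖w (k + 1) s - w k s‖ ≤ (1 / 2) ^ (k + 1) * d * Real.exp (2 * L * (s - a)) := by
        intro s hs
        simp only [hw]
        rw [add_sub_add_left_eq_sub, ← intervalIntegral.integral_sub
          (intervalIntegrable_of_mem_Icc h2 haI hs) (intervalIntegrable_of_mem_Icc h1 haI hs)]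
        refine (intervalIntegral.norm_integral_le_of_norm_le hs.1
          (g := fun r => L * (1 / 2) ^ k * d * Real.exp (2 * L * (r - a))) ?_
          (Continuous.intervalIntegrable (by fun_prop) _ _)).trans ?_
        · filter_upwards [h4] with r h hr using h ⟨hr.1.le, hr.2.trans hs.2⟩
        · rw [intervalIntegral.integral_const_mul, integral_exp_mul_sub (by positivity)]
          have e : L * (1 / 2) ^ k * d * ((Real.exp (2 * L * (s - a)) - 1) / (2 * L))
              = (1 / 2) ^ (k + 1) * d * (Real.exp (2 * L * (s - a)) - 1) := by
            rw [pow_succ]; field_simp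
          rw [e]
          gcongr
          linarith
      have h3' : ∀ s ∈ Icc a b,
          ‖w (k + 1) s - x s‖ ≤ (2 - (1 / 2) ^ (k + 1)) * d * Real.exp (2 * L * (s - a)) := by
        intro s hs
        have e : w (k + 1) s - x s = (w (k + 1) s - w k s) + (w k s - x s) := by abel
        rw [e]
        refine (norm_add_le _ _).trans ((add_le_add (hww s hs) (h3 s hs)).trans_eq ?_)
        rw [pow_succ]; ring
      have h4' : ∀ᵐ s ∂volume, s ∈ Icc a b → ‖u (k + 1 + 1) s - u (k + 1) s‖ ≤
          L * (1 / 2) ^ (k + 1) * d * Real.exp (2 * L * (s - a)) := by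
        refine Eventually.of_forall fun s hs => ?_
        rw [husucc (k + 1) s]
        refine (hLip s _ (htubeK _ _ s hs (h3' s hs)) _ (htubeK _ _ s hs (h3 s hs)) _ ?_).trans ?_
        · rw [husucc k s]
          exact hmem _ _ _
        · have := mul_le_mul_of_nonneg_left (hww s hs) hL.le
          linarith
      exact ⟨h2, hstep (k + 1) h2 _ (hconst (k + 1) h4'), h3', h4'⟩
  set C := 2 * (L * d * M) with hC
  have hdist : ∀ᵐ s ∂volume, s ∈ Icc a b → ∀ k, dist (u k s) (u (k + 1) s) ≤ C / 2 / 2 ^ k := by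
    have := ae_all_iff.2 fun k => (main k).2.2.2
    filter_upwards [this] with s h hs k
    rw [dist_comm, dist_eq_norm]
    refine (h k hs).trans ?_
    calc L * (1 / 2) ^ k * d * Real.exp (2 * L * (s - a)) ≤ L * (1 / 2) ^ k * d * M := by
          gcongr
          exact hexpM s hs
      _ = C / 2 / 2 ^ k := by rw [hC, one_div, inv_pow]; field_simp
  obtain ⟨v, hvm, hv⟩ := exists_stronglyMeasurable_limit_of_tendsto_ae
    (μ := volume.restrict (Ioc a b)) (f := u)
    (fun k => ((intervalIntegrable_iff_integrableOn_Ioc_of_le hab).1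
      (main k).1).aestronglyMeasurable) (by
      rw [ae_restrict_iff' measurableSet_Ioc]
      filter_upwards [hdist] with s h hs
      exact cauchySeq_tendsto_of_complete
        (cauchySeq_of_le_geometric_two (h (Ioc_subset_Icc_self hs))))
  rw [ae_restrict_iff' measurableSet_Ioc] at hv
  have hvu : ∀ᵐ s ∂volume, s ∈ Ioc a b → ∀ k, dist (u k s) (v s) ≤ C / 2 ^ k := by
    filter_upwards [hdist, hv] with s h1 h2 hs k
    exact dist_le_of_le_geometric_two_of_tendsto (h1 (Ioc_subset_Icc_self hs)) (h2 hs) k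
  have hC0 : 0 ≤ C := by positivity
  have hvint : IntervalIntegrable v volume a b := by
    have hx' := (intervalIntegrable_iff_integrableOn_Ioc_of_le hab).1 hx.1
    rw [intervalIntegrable_iff_integrableOn_Ioc_of_le hab]
    have : Integrable (v - x') (volume.restrict (Ioc a b)) := by
      refine Integrable.mono' (integrable_const C)
        (hvm.aestronglyMeasurable.sub hx'.aestronglyMeasurable) ?_
      rw [ae_restrict_iff' measurableSet_Ioc]
      filter_upwards [hvu] with s h hs
      have := h hs 0
      rw [dist_comm, dist_eq_norm, hu0] at this
      simpa using this
    have hadd := this.add hx'.integrable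
    rwa [sub_add_cancel] at hadd
  have hlim : ∀ s ∈ Icc a b, Tendsto (fun k => w k s) atTop (𝓝 (c + ∫ r in a..s, v r)) := by
    intro s hs
    refine tendsto_const_nhds.add ?_
    refine intervalIntegral.tendsto_integral_filter_of_dominated_convergence
      (fun r => ‖x' r‖ + 2 * C) (Eventually.of_forall fun k => ?_)
      (Eventually.of_forall fun k => ?_) ?_ ?_
    · exact (intervalIntegrable_of_mem_Icc (main k).1 haI hs).aestronglyMeasurable_restrict_uIoc
    · filter_upwards [hvu] with r h hr
      rw [uIoc_of_le hs.1] at hr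
      have hr' : r ∈ Ioc a b := ⟨hr.1, hr.2.trans hs.2⟩
      have h1 := h hr' 0
      have h2 := h hr' k
      rw [pow_zero, div_one] at h1
      have h3 : C / 2 ^ k ≤ C := div_le_self hC0 (one_le_pow₀ (by norm_num))
      have h4 : dist (u k r) (x' r) ≤ 2 * C := by
        refine (dist_triangle_right _ _ (v r)).trans ?_
        rw [← hu0]
        linarith
      rw [dist_eq_norm] at h4
      have := norm_le_insert' (u k r) (x' r)
      linarith
    · exact (intervalIntegrable_of_mem_Icc hx.1 haI hs).norm.add (by simp)
    · filter_upwards [hv] with r h hr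
      rw [uIoc_of_le hs.1] at hr
      exact h ⟨hr.1, hr.2.trans hs.2⟩
  have hclose : ∀ s ∈ Icc a b, ‖(c + ∫ r in a..s, v r) - x s‖ ≤ 2 * M * d := by
    intro s hs
    refine le_of_tendsto ((hlim s hs).sub_const (x s)).norm (Eventually.of_forall fun k => ?_)
    refine ((main k).2.2.1 s hs).trans ?_
    have h2 : (2 - (1 / 2 : ℝ) ^ k) ≤ 2 := by
      have : (0:ℝ) ≤ (1 / 2) ^ k := by positivity
      linarith
    calc _ ≤ 2 * d * M := by gcongr; exact hexpM s hs
      _ = _ := by ring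
  refine ⟨_, v, acArc_of_intervalIntegrable hab hvint c, by simp, ?_, hclose⟩
  have hne : ∀ᵐ s : ℝ, s ≠ a := by simp [ae_iff, measure_singleton]
  filter_upwards [hv, hne] with s h hsa hs
  have hs' : s ∈ Ioc a b := ⟨lt_of_le_of_ne hs.1 (Ne.symm hsa), hs.2⟩
  set y := c + ∫ r in a..s, v r with hy
  have hyK : y ∈ K := hK s hs (mem_closedBall_iff_norm.2 ((hclose s hs).trans hc))
  have hu1 : Tendsto (fun k => u (k + 1) s) atTop (𝓝 (v s)) :=
    (h hs').comp (tendsto_add_atTop_nat 1)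
  have h0 : Tendsto (fun k => σ s y (u (k + 1) s) - u (k + 1) s) atTop (𝓝 0) := by
    refine squeeze_zero_norm (a := fun k => L * ‖y - w k s‖) (fun k => ?_) ?_
    · refine hLip s y hyK _ (htubeK k _ s hs ((main k).2.2.1 s hs)) _ ?_
      rw [husucc k s]
      exact hmem _ _ _
    · have hlim0 := ((hlim s hs).const_sub y).norm.const_mul L
      rwa [← hy, sub_self, norm_zero, mul_zero] at hlim0
  have hσ := h0.add hu1
  simp only [sub_add_cancel, zero_add] at hσ
  exact (hcl s y).mem_of_tendsto hσ (Eventually.of_forall fun k => hmem s y _)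

end Filippov

/-! ### Monotonicity of duality products along arcs -/

/-- The inner product of two arcs is absolutely continuous and hence controlled from below by its
derivative. -/
theorem ACArc.inner_sub_inner_ge {n : ℕ} {a b m : ℝ} (hab : a ≤ b) {p p' z z' : ℝ → Euc n}
    (hp : ACArc a b p p') (hz : ACArc a b z z')
    (hm : ∀ᵐ s ∂volume, s ∈ Icc a b → m ≤ ⟪p' s, z s⟫ + ⟪p s, z' s⟫) :
    m * (b - a) ≤ ⟪p b, z b⟫ - ⟪p a, z a⟫ := by
  have hcoord : ∀ {f f' : ℝ → Euc n}, ACArc a b f f' → ∀ i, ∃ g : ℝ → ℝ,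
      AbsolutelyContinuousOnInterval g a b ∧ (∀ s ∈ Icc a b, g s = f s i) ∧
      ∀ᵐ s ∂volume, s ∈ Icc a b → HasDerivAt g (f' s i) s := by
    intro f f' hf i
    have hint : IntervalIntegrable (fun s => f' s i) volume a b :=
      ⟨(EuclideanSpace.proj (𝕜 := ℝ) i).integrable_comp hf.1.1,
        (EuclideanSpace.proj (𝕜 := ℝ) i).integrable_comp hf.1.2⟩
    refine ⟨fun s => f a i + ∫ r in a..s, f' r i, ?_, fun s hs => ?_, ?_⟩
    · have hc : AbsolutelyContinuousOnInterval (fun _ : ℝ => f a i) a b :=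
        (LipschitzWith.const (f a i)).lipschitzOnWith.absolutelyContinuousOnInterval
      exact hc.fun_add (hint.absolutelyContinuousOnInterval_intervalIntegral left_mem_uIcc)
    · have h : ∫ r in a..s, f' r i = (∫ r in a..s, f' r) i :=
        (EuclideanSpace.proj (𝕜 := ℝ) i).intervalIntegral_comp_comm
          (intervalIntegrable_of_mem_Icc hf.1 (left_mem_Icc.2 hab) hs)
      rw [hf.2.1 s hs, PiLp.add_apply, ← h]
    · filter_upwards [hint.ae_hasDerivAt_integral] with s hs hsm
      rw [uIcc_of_le hab] at hs
      exact (hs hsm a (left_mem_Icc.2 hab)).const_add _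
  choose P hPac hPeq hPd using hcoord hp
  choose Z hZac hZeq hZd using hcoord hz
  have hsum : ∀ t : Finset (Fin n),
      AbsolutelyContinuousOnInterval (fun s => ∑ i ∈ t, P i s * Z i s) a b := by
    intro t
    induction t using Finset.cons_induction with
    | empty =>
      simpa using
        (LipschitzWith.const (0:ℝ)).lipschitzOnWith.absolutelyContinuousOnInterval (a := a) (b := b)
    | cons i t hi ih =>
      simp only [Finset.sum_cons]
      exact ((hPac i).fun_mul (hZac i)).fun_add ih
  have hac := hsum Finset.univ
  have hval : ∀ s ∈ Icc a b, ∑ i, P i s * Z i s = ⟪p s, z s⟫ := by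
    intro s hs
    simp only [PiLp.inner_apply, RCLike.inner_apply, conj_trivial, hPeq _ s hs, hZeq _ s hs]
    exact Finset.sum_congr rfl fun i _ => mul_comm _ _
  have hderiv : ∀ᵐ s ∂volume, s ∈ Icc a b → m ≤ deriv (fun s => ∑ i, P i s * Z i s) s := by
    filter_upwards [ae_all_iff.2 hPd, ae_all_iff.2 hZd, hm] with s h1 h2 h3 hs
    have := (HasDerivAt.fun_sum (u := Finset.univ)
      fun i _ => (h1 i hs).mul (h2 i hs)).deriv
    simp only [Pi.mul_apply] at this
    refine (h3 hs).trans_eq ?_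
    rw [this]
    simp only [PiLp.inner_apply, RCLike.inner_apply, conj_trivial, hPeq _ s hs, hZeq _ s hs,
      ← Finset.sum_add_distrib]
    exact Finset.sum_congr rfl fun i _ => by ring
  rw [← hval b (right_mem_Icc.2 hab), ← hval a (left_mem_Icc.2 hab), ← hac.integral_deriv_eq_sub]
  have hmono := intervalIntegral.integral_mono_ae_restrict hab (intervalIntegrable_const (c := m))
    hac.intervalIntegrable_deriv (by
      rw [EventuallyLE, ae_restrict_iff' measurableSet_Icc]
      exact hderiv)
  rwa [intervalIntegral.integral_const, smul_eq_mul, mul_comm] at hmono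

/-! ### The value function -/

section ValueFunction

variable {F : E → Set E} {φ : E → ℝ}

/-- Trajectories from a common initial point end in a common ball, so the infimum defining the
value function is over a set that is bounded below. -/
theorem valueFn_le [ProperSpace E] (hF : StandingHyp F) (hφ : Continuous φ) {t T : ℝ}
    (htT : t ≤ T) {y y' : ℝ → E} (hy : IsTraj F t T y y') :
    valueFn F φ T t (y t) ≤ φ (y T) := by
  obtain ⟨r, hr, hgrowth⟩ := hF.2.2
  refine csInf_le ?_ ⟨y, y', hy, rfl, rfl⟩
  obtain ⟨m, hm⟩ := (isCompact_closedBall (0:E)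
    (2 * (‖y t‖ + r * (T - t)) * Real.exp (2 * r * (T - t)))).bddBelow_image hφ.continuousOn
  refine ⟨m, ?_⟩
  rintro _ ⟨z, z', hz, hzt, rfl⟩
  refine hm (mem_image_of_mem φ (mem_closedBall_zero_iff.2 ?_))
  rw [← hzt]
  exact hz.norm_le hr hgrowth (right_mem_Icc.2 htT)

/-- Principle of optimality: the tail of an optimal trajectory is optimal. -/
theorem IsOptimal.le_valueFn {t0 T t : ℝ} {x0 : E} {x x' : ℝ → E}
    (hx : IsOptimal F φ t0 T x0 x x') (ht : t ∈ Icc t0 T) :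
    φ (x T) ≤ valueFn F φ T t (x t) := by
  refine le_csInf ⟨_, x, x', hx.1.restrict_right ht, rfl, rfl⟩ ?_
  rintro _ ⟨y, y', hy, hyt, rfl⟩
  have h := hx.2.2 _ _ (hx.1.concat ht hy hyt.symm) (by rw [if_pos ht.1, hx.2.1])
  rcases ht.2.eq_or_lt with rfl | hlt
  · rw [hyt]
  · rwa [if_neg hlt.not_ge] at h

end ValueFunction

/-! ### Comparison trajectories near an arc with a dual arc -/

/-- Near an arc `x` with a dual arc `p` there are trajectories with prescribed initial points along
which the duality product grows, up to a quadratic error, at least as along `x`. -/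
theorem exists_isTraj_inner_ge {n : ℕ} {F : Euc n → Set (Euc n)} (hF : StandingHyp F)
    (h1 : HypH1 F) {t T : ℝ} (htT : t ≤ T) {x x' p p' : ℝ → Euc n} (hx : IsTraj F t T x x')
    (hp : ACArc t T p p')
    (hadj : ∀ᵐ s ∂volume, s ∈ Icc t T →
      -p' s ∈ FSub (fun y => Ham F y (p s)) (x s) ∧
      x' s ∈ ClarkeGrad (fun q => Ham F (x s) q) (p s)) :
    ∃ M C : ℝ, 0 < M ∧ 0 ≤ C ∧ ∀ c : Euc n, M * ‖c - x t‖ ≤ 1 →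
      ∃ y y' : ℝ → Euc n, IsTraj F t T y y' ∧ y t = c ∧ ‖y T - x T‖ ≤ M * ‖c - x t‖ ∧
        ⟪p t, c - x t⟫ - C * ‖c - x t‖ ^ 2 ≤ ⟪p T, y T - x T⟫ := by
  obtain ⟨R₀, hR₀⟩ := isCompact_Icc.exists_bound_of_continuousOn hx.1.continuousOn
  obtain ⟨B, hB⟩ := isCompact_Icc.exists_bound_of_continuousOn hp.continuousOn
  have hR₀0 : 0 ≤ R₀ := (norm_nonneg _).trans (hR₀ t (left_mem_Icc.2 htT))
  have hB0 : 0 ≤ B := (norm_nonneg _).trans (hB t (left_mem_Icc.2 htT))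
  have hR : 0 ≤ R₀ + 1 := by positivity
  set K := closedBall (0 : Euc n) (R₀ + 1) with hKdef
  obtain ⟨L, hL, hLip⟩ := exists_norm_faceSel_sub_le hF h1 hR
  obtain ⟨c₀, hc₀, hsc⟩ := h1.1 K (nonempty_closedBall.2 hR) (convex_closedBall _ _)
    (isCompact_closedBall _ _)
  have hball : ∀ s ∈ Icc t T, closedBall (x s) 1 ⊆ K := fun s hs =>
    closedBall_subset_closedBall' (by rw [dist_zero_right]; linarith [hR₀ s hs])
  have hpm : AEMeasurable p (volume.restrict (Ioc t T)) :=
    (hp.continuousOn.mono Ioc_subset_Icc_self).aemeasurable measurableSet_Ioc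
  have hxface : ∀ᵐ s ∂volume, s ∈ Icc t T → x' s ∈ maxFace F (x s) (p s) := by
    filter_upwards [hadj, hx.2] with s h2 h3 hs
    exact mem_maxFace_of_mem_clarkeGrad (hF.isCompact _) (hF.nonempty _)
      (hF.continuous_ham.comp (Continuous.prodMk_right (x s))) (h3 hs) (h2 hs).2
  set M := 2 * Real.exp (2 * L * (T - t)) with hM
  have hT0 : 0 ≤ T - t := sub_nonneg.2 htT
  refine ⟨M, c₀ * B * M ^ 2 * (T - t), by positivity, by positivity, fun c hc => ?_⟩
  obtain ⟨y, y', hy, hyt, hyface, hyx⟩ := exists_acArc_of_selection htT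
    (Φ := fun s z => maxFace F z (p s)) (σ := fun s z v => faceSel F (p s) z v) (K := K)
    (fun s z => isClosed_maxFace (hF.isCompact z) (p s))
    (fun s z v => faceSel_mem hF h1.2.1 (p s) z v) hL
    (fun s z hz z' hz' v hv => hLip (p s) z hz z' hz' v hv)
    (fun y u hy hu => ((measurable_faceSel hF h1.2.1).comp_aemeasurable
      (hpm.prodMk (((hy.mono Ioc_subset_Icc_self).aemeasurable measurableSet_Ioc).prodMk
        hu.aemeasurable))).aestronglyMeasurable)
    hx.1 hxface hball c hc
  have hyT := hyx T (right_mem_Icc.2 htT)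
  refine ⟨y, y', ⟨hy, by filter_upwards [hyface] with s h hs using (h hs).1⟩, hyt, hyT, ?_⟩
  have hmono := ACArc.inner_sub_inner_ge (m := -(c₀ * B * M ^ 2 * ‖c - x t‖ ^ 2)) htT hp
    (hy.sub hx.1) (by
    filter_upwards [hadj, hxface, hyface] with s h2 h3 h4 hs
    have hxK := hball s hs (mem_closedBall_self zero_le_one)
    have hyK := hball s hs (mem_closedBall_iff_norm.2 ((hyx s hs).trans hc))
    have hsub := le_of_mem_fSub_of_semiconvexWith (by positivity) (convex_closedBall _ _)
      (hsc (p s)) hxK hyK (h2 hs).1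
    rw [inner_neg_left, ← (h3 hs).2, ← (h4 hs).2, real_inner_comm, real_inner_comm (p s) (x' s)]
      at hsub
    have hquad : c₀ * ‖p s‖ * ‖y s - x s‖ ^ 2 ≤ c₀ * B * (M * ‖c - x t‖) ^ 2 := by
      gcongr
      · exact hB s hs
      · exact hyx s hs
    rw [inner_sub_right (p s)]
    linarith)
  rw [hyt] at hmono
  linarith

/-- Remark 3.4, Fréchet partial sensitivity relation.
Under (SH), (H1), with `φ` locally Lipschitz, if `x̄` is optimal for `P(t₀,x₀)` and `p̄`
solves the Hamiltonian adjoint inclusion with `−p̄(T) ∈ ∂⁺φ(x̄(T))`, then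
`−p̄(t) ∈ ∂ₓ⁺V(t,x̄(t))` for all `t ∈ [t₀,T]`. -/
theorem stmt10 {n : ℕ} (F : Euc n → Set (Euc n)) (φ : Euc n → ℝ)
    (t0 T : ℝ) (x0 : Euc n) (xbar xbar' pbar pbar' : ℝ → Euc n)
    (hSH : StandingHyp F) (hH1 : HypH1 F) (hφ : LocallyLipschitz φ) (ht : t0 < T)
    (hopt : IsOptimal F φ t0 T x0 xbar xbar')
    (hpAC : ACArc t0 T pbar pbar')
    (hadj : ∀ᵐ t ∂volume, t ∈ Icc t0 T →
      -pbar' t ∈ FSub (fun y => Ham F y (pbar t)) (xbar t) ∧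
      xbar' t ∈ ClarkeGrad (fun q => Ham F (xbar t) q) (pbar t))
    (htrans : -pbar T ∈ FSuper φ (xbar T)) :
    ∀ t ∈ Icc t0 T, -pbar t ∈ FSuper (fun y => valueFn F φ T t y) (xbar t) := by
  intro t ht'
  have hadj' : ∀ᵐ s ∂volume, s ∈ Icc t T →
      -pbar' s ∈ FSub (fun y => Ham F y (pbar s)) (xbar s) ∧
      xbar' s ∈ ClarkeGrad (fun q => Ham F (xbar s) q) (pbar s) := by
    filter_upwards [hadj] with s h hs using h (Icc_subset_Icc_left ht'.1 hs)
  obtain ⟨M, C, hM, hC, hcomp⟩ := exists_isTraj_inner_ge hSH hH1 ht'.2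
    (hopt.1.restrict_right ht') (hpAC.restrict_right ht') hadj'
  intro ε hε
  obtain ⟨ρ, hρ, hφT⟩ := Metric.eventually_nhds_iff.1 (htrans (ε / (2 * M)) (by positivity))
  have hd : Tendsto (fun c => ‖c - xbar t‖) (𝓝 (xbar t)) (𝓝 0) := by
    simpa using (continuous_id.sub (continuous_const (y := xbar t))).norm.tendsto (xbar t)
  have hMd := hd.const_mul M
  have hCd := hd.const_mul C
  rw [mul_zero] at hMd hCd
  filter_upwards [hMd.eventually_lt_const (lt_min one_pos hρ),
    hCd.eventually_lt_const (half_pos hε)] with c hc1 hc2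
  obtain ⟨y, y', hy, rfl, hyT, hdual⟩ := hcomp c (hc1.le.trans (min_le_left _ _))
  have hup := valueFn_le hSH hφ.continuous ht'.2 hy
  have hlow := hopt.le_valueFn ht'
  have hend := hφT (y := y T) (by
    rw [dist_eq_norm]
    exact hyT.trans_lt (hc1.trans_le (min_le_right _ _)))
  have hfst : ε / (2 * M) * ‖y T - xbar T‖ ≤ ε / 2 * ‖y t - xbar t‖ := by
    refine (mul_le_mul_of_nonneg_left hyT (by positivity)).trans_eq ?_
    field_simp
  have hsnd := mul_le_mul_of_nonneg_right hc2.le (norm_nonneg (y t - xbar t))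
  rw [inner_neg_left] at hend ⊢
  linarith

end
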